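/- arXiv:0902.3483 — 2 statements merged into one kernel-verified Lean document; each statement's English description precedes it below -/
import Mathlib

section
/- Let X and Y be Banach spaces, let K be a compact subset of X whose linear span is infinite-dimensional, and let T : X → Y be a compact bounded linear operator such that the linear span of TK is infinite-dimensional. Then d̃_n(TK)/d̃_n(K) → 0 as n → ∞, where d̃_n(M) denotes the Kolmogorov n-width of M computed inside the closed linear span of M. -/
open Filter Topology Metric
open scoped ENNReal NNReal

/-- The Kolmogorov `n`-width of a set `M` computed inside the closed linear span of `M`:
the infimum over `n`-dimensional subspaces contained in the closed span of `M` of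
`sup_{x ∈ M} dist(x, V)`. -/
noncomputable def kolWidthIn {X : Type*} [NormedAddCommGroup X] [NormedSpace ℝ X]
    (M : Set X) (n : ℕ) : ℝ≥0∞ :=
  ⨅ (V : Submodule ℝ X) (_ : FiniteDimensional ℝ V ∧ Module.finrank ℝ V = n ∧
      V ≤ (Submodule.span ℝ M).topologicalClosure),
    ⨆ x ∈ M, EMetric.infEdist x (V : Set X)

theorem kw_extend {X : Type*} [NormedAddCommGroup X] [NormedSpace ℝ X]
    (S : Submodule ℝ X) (hS : ¬ FiniteDimensional ℝ S) (V : Submodule ℝ X)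
    (hV : FiniteDimensional ℝ V) (hVS : V ≤ S) (j : ℕ) :
    ∃ W : Submodule ℝ X, FiniteDimensional ℝ W ∧
      Module.finrank ℝ W = Module.finrank ℝ V + j ∧ W ≤ S ∧ V ≤ W := by
  induction j with
  | zero => exact ⟨V, hV, rfl, hVS, le_rfl⟩
  | succ j ih =>
    obtain ⟨W, hW, hr, hWS, hVW⟩ := ih
    have : ¬ S ≤ W := fun h => hS (Submodule.finiteDimensional_of_le h)
    obtain ⟨x, hxS, hxW⟩ := SetLike.not_le_iff_exists.1 this
    refine ⟨W ⊔ Submodule.span ℝ {x}, inferInstance, ?_, ?_, hVW.trans le_sup_left⟩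
    · have h0 : x ≠ 0 := fun h => hxW (h ▸ W.zero_mem)
      have h1 := Submodule.finrank_sup_add_finrank_inf_eq W (Submodule.span ℝ {x})
      rw [(Submodule.disjoint_span_singleton_of_notMem hxW).eq_bot, finrank_bot,
        finrank_span_singleton h0, hr] at h1
      omega
    · refine sup_le hWS ?_
      rw [Submodule.span_singleton_le_iff_mem]; exact hxS

theorem kw_upper {X : Type*} [NormedAddCommGroup X] [NormedSpace ℝ X] (M : Set X)
    (hM : ¬ FiniteDimensional ℝ (Submodule.span ℝ M)) (n : ℕ) (V : Submodule ℝ X)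
    (hV : FiniteDimensional ℝ V) (hn : Module.finrank ℝ V ≤ n)
    (hVS : V ≤ (Submodule.span ℝ M).topologicalClosure) (r : ℝ)
    (h : ∀ x ∈ M, ∃ v ∈ V, ‖x - v‖ ≤ r) : kolWidthIn M n ≤ ENNReal.ofReal r := by
  have hS : ¬ FiniteDimensional ℝ (Submodule.span ℝ M).topologicalClosure := fun h' =>
    hM (Submodule.finiteDimensional_of_le (Submodule.le_topologicalClosure _))
  obtain ⟨W, hW, hr, hWS, hVW⟩ := kw_extend _ hS V hV hVS (n - Module.finrank ℝ V)
  refine iInf₂_le_of_le W ⟨hW, by omega, hWS⟩ (iSup₂_le fun x hx => ?_)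
  obtain ⟨v, hv, hxv⟩ := h x hx
  refine (Metric.infEDist_le_edist_of_mem (hVW hv)).trans ?_
  rw [edist_dist, dist_eq_norm]
  exact ENNReal.ofReal_le_ofReal hxv

theorem kw_lower {X : Type*} [NormedAddCommGroup X] [NormedSpace ℝ X] (M : Set X) (n : ℕ)
    (r : ℝ) (h : kolWidthIn M n < ENNReal.ofReal r) :
    ∃ V : Submodule ℝ X, FiniteDimensional ℝ V ∧ Module.finrank ℝ V = n ∧
      V ≤ (Submodule.span ℝ M).topologicalClosure ∧ ∀ x ∈ M, ∃ v ∈ V, ‖x - v‖ < r := by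
  unfold kolWidthIn at h
  simp only [iInf_lt_iff] at h
  obtain ⟨V, ⟨h1, h2, h3⟩, h4⟩ := h
  refine ⟨V, h1, h2, h3, fun x hx => ?_⟩
  have h5 : Metric.infEDist x (V : Set X) < ENNReal.ofReal r :=
    lt_of_le_of_lt (le_iSup₂ (f := fun x (_ : x ∈ M) => Metric.infEDist x (V : Set X)) x hx) h4
  obtain ⟨v, hv, hlt⟩ := Metric.infEDist_lt_iff.1 h5
  refine ⟨v, hv, ?_⟩
  rw [edist_dist, dist_eq_norm] at hlt
  exact (ENNReal.ofReal_lt_ofReal_iff_of_nonneg (norm_nonneg _)).1 hlt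

theorem kw_dense {X : Type*} [NormedAddCommGroup X] [NormedSpace ℝ X] (K : Set X) (x : X)
    (hx : x ∈ (Submodule.span ℝ K).topologicalClosure) :
    ∀ ε > 0, ∃ δ > 0, ∀ V : Submodule ℝ X, (∀ k ∈ K, ∃ v ∈ V, ‖k - v‖ < δ) →
      ∃ v ∈ V, ‖x - v‖ < (ε : ℝ) := by
  have key : ∀ y ∈ Submodule.span ℝ K, ∀ ε > 0, ∃ δ > 0, ∀ V : Submodule ℝ X,
      (∀ k ∈ K, ∃ v ∈ V, ‖k - v‖ < δ) → ∃ v ∈ V, ‖y - v‖ < (ε : ℝ) := by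
    intro y hy
    induction hy using Submodule.span_induction with
    | mem k hk => exact fun ε hε => ⟨ε, hε, fun V hV => hV k hk⟩
    | zero => exact fun ε hε => ⟨1, one_pos, fun V _ => ⟨0, V.zero_mem, by simpa using hε⟩⟩
    | add a b _ _ iha ihb =>
      intro ε hε
      obtain ⟨δ₁, h1, H1⟩ := iha (ε / 2) (by positivity)
      obtain ⟨δ₂, h2, H2⟩ := ihb (ε / 2) (by positivity)
      refine ⟨min δ₁ δ₂, lt_min h1 h2, fun V hV => ?_⟩
      obtain ⟨v, hv, hav⟩ := H1 V fun k hk =>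
        let ⟨v, hv, h⟩ := hV k hk; ⟨v, hv, h.trans_le (min_le_left _ _)⟩
      obtain ⟨w, hw, hbw⟩ := H2 V fun k hk =>
        let ⟨v, hv, h⟩ := hV k hk; ⟨v, hv, h.trans_le (min_le_right _ _)⟩
      refine ⟨v + w, V.add_mem hv hw, ?_⟩
      have : a + b - (v + w) = (a - v) + (b - w) := by abel
      rw [this]
      linarith [norm_add_le (a - v) (b - w)]
    | smul c a _ iha =>
      intro ε hε
      obtain ⟨δ, h1, H1⟩ := iha (ε / (|c| + 1)) (by positivity)
      refine ⟨δ, h1, fun V hV => ?_⟩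
      obtain ⟨v, hv, hav⟩ := H1 V hV
      refine ⟨c • v, V.smul_mem c hv, ?_⟩
      rw [← smul_sub, norm_smul, Real.norm_eq_abs]
      rw [lt_div_iff₀ (by positivity)] at hav
      nlinarith [norm_nonneg (a - v)]
  intro ε hε
  have hx' : x ∈ closure (Submodule.span ℝ K : Set X) := hx
  obtain ⟨y, hy, hxy⟩ := Metric.mem_closure_iff.1 hx' (ε / 2) (by positivity)
  obtain ⟨δ, hδ, H⟩ := key y hy (ε / 2) (by positivity)
  refine ⟨δ, hδ, fun V hV => ?_⟩
  obtain ⟨v, hv, hyv⟩ := H V hV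
  refine ⟨v, hv, ?_⟩
  rw [dist_eq_norm] at hxy
  have : x - v = (x - y) + (y - v) := by abel
  rw [this]
  linarith [norm_add_le (x - y) (y - v)]

/-- A bounded number of closeness conditions can be met simultaneously. -/
theorem kw_dense_finite {X : Type*} [NormedAddCommGroup X] [NormedSpace ℝ X] (K : Set X)
    (F : Set X) (hF : F.Finite) :
    F ⊆ (Submodule.span ℝ K).topologicalClosure →
    ∀ ε > 0, ∃ δ > 0, ∀ V : Submodule ℝ X, (∀ k ∈ K, ∃ v ∈ V, ‖k - v‖ < δ) →
      ∀ x ∈ F, ∃ v ∈ V, ‖x - v‖ < (ε : ℝ) := by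
  induction F, hF using Set.Finite.induction_on with
  | empty => exact fun _ ε hε => ⟨1, one_pos, fun V _ x hx => absurd hx (Set.notMem_empty x)⟩
  | @insert a s _ _ ih =>
    intro hsub ε hε
    obtain ⟨δ₁, h1, H1⟩ := ih (fun x hx => hsub (Set.mem_insert_of_mem _ hx)) ε hε
    obtain ⟨δ₂, h2, H2⟩ := kw_dense K a (hsub (Set.mem_insert _ _)) ε hε
    refine ⟨min δ₁ δ₂, lt_min h1 h2, fun V hV x hx => ?_⟩
    rcases Set.mem_insert_iff.1 hx with rfl | hx
    · exact H2 V fun k hk =>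
        let ⟨v, hv, h⟩ := hV k hk; ⟨v, hv, h.trans_le (min_le_right _ _)⟩
    · refine H1 V (fun k hk => ?_) x hx
      obtain ⟨v, hv, h⟩ := hV k hk
      exact ⟨v, hv, h.trans_le (min_le_left _ _)⟩

theorem kw_unif {X : Type*} [NormedAddCommGroup X] [NormedSpace ℝ X]
    {Y : Type*} [NormedAddCommGroup Y] [NormedSpace ℝ Y]
    (K : Set X) (T : X →L[ℝ] Y) (hT : IsCompactOperator T) (ε : ℝ) (hε : 0 < ε) :
    ∃ δ > 0, ∀ V : Submodule ℝ X, (∀ k ∈ K, ∃ v ∈ V, ‖k - v‖ < δ) →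
      ∀ x ∈ (Submodule.span ℝ K).topologicalClosure, ‖x‖ ≤ 1 →
        ∃ v ∈ V, ‖T x - T v‖ < ε := by
  set S := (Submodule.span ℝ K).topologicalClosure with hSdef
  have hc : IsCompact (closure (T '' Metric.closedBall 0 1)) :=
    IsCompactOperator.isCompact_closure_image_closedBall (f := (T : X →ₗ[ℝ] Y)) hT 1
  have htb : TotallyBounded (T '' ((S : Set X) ∩ Metric.closedBall 0 1)) :=
    hc.totallyBounded.subset
      ((Set.image_mono Set.inter_subset_right).trans subset_closure)
  obtain ⟨t, hts, htf, hcov⟩ :=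
    Metric.finite_approx_of_totallyBounded htb (ε / 2) (by positivity)
  obtain ⟨F, hFs, hFf, rfl⟩ : ∃ F : Set X, F ⊆ (S : Set X) ∩ Metric.closedBall 0 1 ∧
      F.Finite ∧ T '' F = t := by
    have hts' : ∀ y ∈ t, ∃ x, x ∈ (S : Set X) ∩ Metric.closedBall 0 1 ∧ T x = y := hts
    choose! g hg using hts'
    refine ⟨g '' t, ?_, htf.image g, ?_⟩
    · rintro _ ⟨y, hy, rfl⟩
      exact (hg y hy).1
    · rw [Set.image_image, Set.image_congr (fun y hy => (hg y hy).2), Set.image_id']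
  obtain ⟨δ, hδ, H⟩ := kw_dense_finite K F hFf (fun x hx => (hFs hx).1)
    (ε / 2 / (‖T‖ + 1)) (by positivity)
  refine ⟨δ, hδ, fun V hV x hx hx1 => ?_⟩
  have := hcov ⟨x, ⟨hx, by simpa using hx1⟩, rfl⟩
  simp only [Set.mem_iUnion, Set.mem_image, Metric.mem_ball, dist_eq_norm, exists_prop] at this
  obtain ⟨_, ⟨z, hz, rfl⟩, hxz⟩ := this
  obtain ⟨v, hv, hzv⟩ := H V hV z hz
  refine ⟨v, hv, ?_⟩
  rw [lt_div_iff₀ (by positivity)] at hzv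
  have h1 : ‖T z - T v‖ ≤ ‖T‖ * ‖z - v‖ := by
    rw [← map_sub]; exact T.le_opNorm _
  have h2 : T x - T v = (T x - T z) + (T z - T v) := by abel
  rw [h2]
  nlinarith [norm_add_le (T x - T z) (T z - T v), norm_nonneg (z - v)]

theorem kw_tendsto {X : Type*} [NormedAddCommGroup X] [NormedSpace ℝ X]
    (K : Set X) (hK : IsCompact K)
    (hinfK : ¬ FiniteDimensional ℝ (Submodule.span ℝ K)) (δ : ℝ) (hδ : 0 < δ) :
    ∃ N, ∀ n ≥ N, kolWidthIn K n < ENNReal.ofReal δ := by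
  obtain ⟨t, hts, htf, hcov⟩ := hK.finite_cover_balls (half_pos hδ)
  have hfd : FiniteDimensional ℝ (Submodule.span ℝ t) := FiniteDimensional.span_of_finite ℝ htf
  refine ⟨Module.finrank ℝ (Submodule.span ℝ t), fun n hn => ?_⟩
  refine lt_of_le_of_lt (kw_upper K hinfK n (Submodule.span ℝ t) hfd hn
    ((Submodule.span_mono hts).trans (Submodule.le_topologicalClosure _)) (δ / 2) ?_)
    ((ENNReal.ofReal_lt_ofReal_iff hδ).2 (by linarith))
  intro x hx
  have := hcov hx
  simp only [Set.mem_iUnion, Metric.mem_ball, dist_eq_norm, exists_prop] at this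
  obtain ⟨z, hz, hxz⟩ := this
  exact ⟨z, Submodule.subset_span hz, hxz.le⟩

theorem kw_main {X : Type*} [NormedAddCommGroup X] [NormedSpace ℝ X]
    {Y : Type*} [NormedAddCommGroup Y] [NormedSpace ℝ Y]
    (K : Set X) (T : X →L[ℝ] Y)
    (hinfTK : ¬ FiniteDimensional ℝ (Submodule.span ℝ (T '' K))) (ε δ : ℝ)
    (H : ∀ V : Submodule ℝ X, (∀ k ∈ K, ∃ v ∈ V, ‖k - v‖ < δ) →
      ∀ x ∈ (Submodule.span ℝ K).topologicalClosure, ‖x‖ ≤ 1 →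
        ∃ v ∈ V, ‖T x - T v‖ < ε) (n : ℕ) (η : ℝ) (hη : 0 < η) (hηδ : η ≤ δ)
    (h : kolWidthIn K n < ENNReal.ofReal η) :
    kolWidthIn (T '' K) n ≤ ENNReal.ofReal (η * ε) := by
  obtain ⟨V, hV, hr, hVS, hap⟩ := kw_lower K n η h
  refine kw_upper _ hinfTK n (V.map (T : X →ₗ[ℝ] Y)) inferInstance
    ((Submodule.finrank_map_le _ _).trans hr.le) ?_ _ ?_
  · rintro _ ⟨v, hv, rfl⟩
    have hv' : v ∈ closure (Submodule.span ℝ K : Set X) := hVS hv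
    have h2 := map_mem_closure (t := (Submodule.span ℝ (T '' K) : Set Y)) T.continuous hv' ?_
    · exact h2
    · intro x hx
      have : T x ∈ (Submodule.span ℝ K).map (T : X →ₗ[ℝ] Y) := ⟨x, hx, rfl⟩
      rw [Submodule.map_span] at this
      exact this
  · rintro _ ⟨k, hk, rfl⟩
    obtain ⟨v, hv, hkv⟩ := hap k hk
    have hkS : k - v ∈ (Submodule.span ℝ K).topologicalClosure :=
      Submodule.sub_mem _ (Submodule.le_topologicalClosure _ (Submodule.subset_span hk)) (hVS hv)
    obtain ⟨w, hw, hlt⟩ := H V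
      (fun k hk => let ⟨v, hv, h⟩ := hap k hk; ⟨v, hv, h.trans_le hηδ⟩)
      (η⁻¹ • (k - v)) (Submodule.smul_mem _ _ hkS) (by
        rw [norm_smul, norm_inv, Real.norm_of_nonneg hη.le, inv_mul_le_iff₀ hη]
        linarith)
    refine ⟨T (v + η • w), ⟨_, V.add_mem hv (V.smul_mem η hw), rfl⟩, ?_⟩
    have : T k - T (v + η • w) = η • (T (η⁻¹ • (k - v)) - T w) := by
      rw [smul_sub, ← map_smul, ← map_smul, smul_inv_smul₀ hη.ne', map_add, map_sub]
      abel
    rw [this, norm_smul, Real.norm_of_nonneg hη.le]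
    exact mul_le_mul_of_nonneg_left hlt.le hη.le

/-- If `T` is a compact operator and `K` a compact set (with `lin K` and `lin TK` both
infinite-dimensional), then `d̃ₙ(TK)/d̃ₙ(K) → 0`. -/
theorem kolWidthIn_image_div_tendsto_zero_of_compactOperator
    {X : Type*} [NormedAddCommGroup X] [NormedSpace ℝ X] [CompleteSpace X]
    {Y : Type*} [NormedAddCommGroup Y] [NormedSpace ℝ Y] [CompleteSpace Y]
    (K : Set X) (hK : IsCompact K)
    (hinfK : ¬ FiniteDimensional ℝ (Submodule.span ℝ K))
    (T : X →L[ℝ] Y) (hT : IsCompactOperator T)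
    (hinfTK : ¬ FiniteDimensional ℝ (Submodule.span ℝ (T '' K))) :
    Filter.Tendsto (fun n => kolWidthIn (T '' K) n / kolWidthIn K n)
      Filter.atTop (nhds (0 : ℝ≥0∞)) := by
  rw [ENNReal.tendsto_nhds_zero]
  intro e he
  obtain ⟨ε, hε, hεe⟩ : ∃ ε : ℝ, 0 < ε ∧ ENNReal.ofReal ε ≤ e := by
    obtain ⟨r, hr0, hr⟩ := ENNReal.lt_iff_exists_nnreal_btwn.1 he
    exact ⟨r, by exact_mod_cast hr0, by simpa using hr.le⟩
  obtain ⟨δ, hδ, H⟩ := kw_unif K T hT ε hε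
  obtain ⟨N, hN⟩ := kw_tendsto K hK hinfK δ hδ
  filter_upwards [eventually_ge_atTop N] with n hn
  refine le_trans (ENNReal.div_le_of_le_mul ?_) hεe
  have hε0 : ENNReal.ofReal ε ≠ 0 := by simpa using hε
  rw [mul_comm, ← ENNReal.div_le_iff hε0 ENNReal.ofReal_ne_top]
  refine le_of_forall_gt_imp_ge_of_dense fun a ha => ?_
  have ha' : kolWidthIn K n < min a (ENNReal.ofReal δ) := lt_min ha (hN n hn)
  have hfin : min a (ENNReal.ofReal δ) ≠ ⊤ :=
    ne_top_of_le_ne_top ENNReal.ofReal_ne_top (min_le_right _ _)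
  have hpos : 0 < (min a (ENNReal.ofReal δ)).toReal :=
    ENNReal.toReal_pos (ne_bot_of_gt ha') hfin
  have := kw_main K T hinfTK ε δ H n _ hpos
    (ENNReal.toReal_le_of_le_ofReal hδ.le (min_le_right _ _))
    (by rw [ENNReal.ofReal_toReal hfin]; exact ha')
  rw [ENNReal.ofReal_mul hpos.le, ENNReal.ofReal_toReal hfin] at this
  exact (ENNReal.div_le_of_le_mul this).trans (min_le_left _ _)
end

section
/- Let H be an infinite-dimensional separable Hilbert space. For every bounded linear operator B on H, the set P(B) = {(X, Y) ∈ L(H) × L(H) : X ∘ Y = B} of all factorizations of B is dense in L(H) × L(H) with respect to the product of the strong operator topologies. -/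
open Filter Topology Metric

/-- An infinite-dimensional separable Hilbert space has a Hilbert basis indexed by the naturals. -/
theorem exists_nat_hilbertBasis {E : Type*} [NormedAddCommGroup E] [InnerProductSpace ℝ E]
    [CompleteSpace E] [TopologicalSpace.SeparableSpace E] (hE : ¬ FiniteDimensional ℝ E) :
    Nonempty (HilbertBasis ℕ ℝ E) := by
  obtain ⟨w, b, hb⟩ := exists_hilbertBasis ℝ E
  have hc : Countable w := by
    refine Pairwise.countable_of_isOpen_disjoint (s := fun i : w => ball (b i) (1 / 2)) ?_
      (fun i => isOpen_ball) (fun i => ⟨b i, mem_ball_self (by norm_num)⟩)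
    intro i j hij
    refine ball_disjoint_ball ?_
    have h0 : inner ℝ (b i) (b j) = 0 := b.orthonormal.2 hij
    have h1 := norm_sub_sq_real (b i) (b j)
    rw [h0, b.orthonormal.1 i, b.orthonormal.1 j] at h1
    rw [dist_eq_norm]
    nlinarith [norm_nonneg (b i - b j)]
  have hi : Infinite w := by
    by_contra h
    rw [not_infinite_iff_finite] at h
    have := Fintype.ofFinite w
    exact hE (b.toOrthonormalBasis.toBasis.finiteDimensional_of_finite)
  obtain ⟨e⟩ : Nonempty (ℕ ≃ w) := nonempty_equiv_of_countable
  refine ⟨HilbertBasis.mk (v := fun n => b (e n)) (b.orthonormal.comp e e.injective) ?_⟩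
  have hr : Set.range (fun n => b (e n)) = Set.range b := e.surjective.range_comp b
  rw [hr, b.dense_span]

/-- `H` embeds isometrically onto the orthogonal complement of a finite-dimensional subspace. -/
theorem exists_equiv_orthogonal {H : Type*} [NormedAddCommGroup H] [InnerProductSpace ℝ H]
    [CompleteSpace H] [TopologicalSpace.SeparableSpace H] (hH : ¬ FiniteDimensional ℝ H)
    (M : Submodule ℝ H) [FiniteDimensional ℝ M] : Nonempty (H ≃ₗᵢ[ℝ] Mᗮ) := by
  have hM : ¬ FiniteDimensional ℝ Mᗮ := by
    intro h
    have h2 : FiniteDimensional ℝ (M ⊔ Mᗮ : Submodule ℝ H) := inferInstance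
    rw [Submodule.sup_orthogonal_of_hasOrthogonalProjection] at h2
    exact hH (Module.finite_def.2 (Module.Finite.iff_fg.1 h2))
  have := UniformSpace.secondCountable_of_separable H
  obtain ⟨b⟩ := exists_nat_hilbertBasis hH
  obtain ⟨c⟩ := exists_nat_hilbertBasis hM
  exact ⟨b.repr.trans c.repr.symm⟩

/-- The key construction. -/
theorem exists_factorization {H : Type*} [NormedAddCommGroup H] [InnerProductSpace ℝ H]
    [CompleteSpace H] [TopologicalSpace.SeparableSpace H] (hH : ¬ FiniteDimensional ℝ H)
    (B X Y : H →L[ℝ] H) (s : Finset H) (n : ℕ) :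
    ∃ X' Y' : H →L[ℝ] H, X'.comp Y' = B ∧ (∀ x ∈ s, X' x = X x) ∧
      ∀ y ∈ s, ‖Y' y - Y y‖ ≤ ‖y‖ * (1 / ((n : ℝ) + 1)) := by
  classical
  let M : Submodule ℝ H := Submodule.span ℝ ((s ∪ s.image Y : Finset H) : Set H)
  have hfd : FiniteDimensional ℝ M := FiniteDimensional.span_finset ℝ _
  obtain ⟨e⟩ := exists_equiv_orthogonal hH M
  let P : H →L[ℝ] H := M.starProjection
  let V : H →L[ℝ] H := Mᗮ.subtypeL.comp (e : H →L[ℝ] Mᗮ)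
  let W : H →L[ℝ] H := (e.symm : Mᗮ →L[ℝ] H).comp Mᗮ.orthogonalProjectionOnto
  have hWV : ∀ x, W (V x) = x := fun x => by simp [W, V]
  have hPV : ∀ x, P (V x) = 0 := fun x =>
    (Submodule.starProjection_apply_eq_zero_iff M).2 (e x).2
  have hWM : ∀ x ∈ M, W x = 0 := fun x hx => by
    have : Mᗮ.orthogonalProjectionOnto x = 0 :=
      Submodule.orthogonalProjectionOnto_apply_of_mem_orthogonal (M.le_orthogonal_orthogonal hx)
    simp [W, this]
  have hPM : ∀ x ∈ M, P x = x := fun x hx => Submodule.starProjection_eq_self_iff.2 hx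
  have hPmem : ∀ x, P x ∈ M := fun x => M.starProjection_apply_mem x
  have hPP : ∀ x, P (P x) = P x := fun x => hPM _ (hPmem x)
  have hWP : ∀ x, W (P x) = 0 := fun x => hWM _ (hPmem x)
  have hVn : ∀ x, ‖V x‖ = ‖x‖ := fun x => e.norm_map x
  have hs : ∀ x ∈ s, x ∈ M := fun x hx => Submodule.subset_span (by simp [hx])
  have hYs : ∀ x ∈ s, Y x ∈ M := fun x hx =>
    Submodule.subset_span (by
      simp only [Finset.coe_union, Finset.coe_image]
      exact Or.inr ⟨x, hx, rfl⟩)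
  clear_value P V W
  let C : H →L[ℝ] H := B - X.comp (P.comp Y)
  have hC : ∀ x, C x = B x - X (P (Y x)) := fun x => rfl
  let δ : ℝ := 1 / (((n : ℝ) + 1) * (‖C‖ + 1))
  have hn : (0 : ℝ) < (n : ℝ) + 1 := by positivity
  have hC1 : 0 < ‖C‖ + 1 := by positivity
  have hδ : 0 < δ := by positivity
  refine ⟨X.comp P + δ⁻¹ • W, P.comp Y + δ • V.comp C, ?_, ?_, ?_⟩
  · ext x
    simp [hPP, hPV, hWP, hWV, hC, hδ.ne']
  · intro x hx
    simp [hPM x (hs x hx), hWM x (hs x hx)]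
  · intro y hy
    have h1 : (P.comp Y + δ • V.comp C) y - Y y = δ • V (C y) := by
      simp [hPM _ (hYs y hy)]
    rw [h1, norm_smul, hVn, Real.norm_of_nonneg hδ.le]
    calc δ * ‖C y‖ ≤ δ * ((‖C‖ + 1) * ‖y‖) := by
          gcongr
          exact (C.le_opNorm y).trans (by gcongr; linarith)
      _ = ‖y‖ * (1 / ((n : ℝ) + 1)) := by
          simp only [δ]
          field_simp

/-- For every bounded operator `B` on an infinite-dimensional separable Hilbert space, the
set of factorizations `{(X, Y) : X ∘ Y = B}` is dense in `L(H) × L(H)` for the product of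
the strong operator topologies (i.e. pointwise convergence, expressed via the embedding
into `(H → H) × (H → H)` with the product/pointwise topology). -/
theorem factorizations_SOT_dense
    {H : Type*} [NormedAddCommGroup H] [InnerProductSpace ℝ H] [CompleteSpace H]
    [TopologicalSpace.SeparableSpace H] (hH : ¬ FiniteDimensional ℝ H)
    (B : H →L[ℝ] H) (X Y : H →L[ℝ] H) :
    ((⇑X, ⇑Y) : (H → H) × (H → H)) ∈
      closure {p : (H → H) × (H → H) |
        ∃ X' Y' : H →L[ℝ] H, X'.comp Y' = B ∧ p = (⇑X', ⇑Y')} := by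
  choose X' Y' h1 h2 h3 using exists_factorization hH B X Y
  refine mem_closure_of_tendsto (b := (atTop : Filter (Finset H)) ×ˢ (atTop : Filter ℕ))
    (f := fun p => ((⇑(X' p.1 p.2), ⇑(Y' p.1 p.2)) : (H → H) × (H → H))) ?_
    (Eventually.of_forall fun p => ⟨_, _, h1 p.1 p.2, rfl⟩)
  have hev : ∀ x : H, ∀ᶠ p : Finset H × ℕ in atTop ×ˢ atTop, x ∈ p.1 := fun x => by
    refine tendsto_fst.eventually (p := fun s : Finset H => x ∈ s) ?_
    filter_upwards [eventually_ge_atTop {x}] with s hs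
    exact hs (Finset.mem_singleton_self x)
  refine Tendsto.prodMk_nhds ?_ ?_
  · rw [tendsto_pi_nhds]
    intro x
    refine tendsto_const_nhds.congr' ?_
    filter_upwards [hev x] with p hp
    exact (h2 p.1 p.2 x hp).symm
  · rw [tendsto_pi_nhds]
    intro y
    rw [tendsto_iff_norm_sub_tendsto_zero]
    have hl : Tendsto (fun p : Finset H × ℕ => ‖y‖ * (1 / ((p.2 : ℝ) + 1)))
        (atTop ×ˢ atTop) (𝓝 0) := by
      have := (tendsto_one_div_add_atTop_nhds_zero_nat (𝕜 := ℝ)).const_mul ‖y‖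
      rw [mul_zero] at this
      exact this.comp tendsto_snd
    refine squeeze_zero' (Eventually.of_forall fun p => norm_nonneg _) ?_ hl
    filter_upwards [hev y] with p hp
    exact h3 p.1 p.2 y hp
end
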